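/- Let G be the series composition of multigraphs G1 and G2 at a vertex t, let a, s ∈ V1 \ {t} be distinct, let b ∈ V2 \ {t}, and let r_a, r_s, r_t, r_b ∈ ℤ with r_a + r_s + r_t + r_b = 0. Then mincost(G, [a ↦ r_a, s ↦ r_s, t ↦ r_t, b ↦ r_b]) = mincost(G1, [a ↦ r_a, s ↦ r_s, t ↦ −r_a − r_s]) + mincost(G2, [t ↦ r_t + r_a + r_s, b ↦ r_b]), where the addition is in ℕ∞. -/

import Mathlib

open scoped BigOperators

/-- An undirected multigraph on vertex type `V` with edge type `E`:
each edge has a reference orientation `src e → tgt e`, a cost `c e` and a capacity `u e`. -/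
structure Multigraph (V E : Type) where
  src : E → V
  tgt : E → V
  c : E → ℕ
  u : E → ℕ

variable {V E : Type}

/-- The residue of a flow assignment `f : E → ℤ` at a vertex `v`:
inflow (w.r.t. the reference orientation) minus outflow. -/
def Multigraph.residue [Fintype E] [DecidableEq V] (G : Multigraph V E)
    (f : E → ℤ) (v : V) : ℤ :=
  (∑ e : E, if G.tgt e = v then f e else 0) - (∑ e : E, if G.src e = v then f e else 0)

/-- `f` is an `r`-circulation supported on `F`: it vanishes outside `F`,
respects capacities, and has residue `r v` at every vertex `v`. -/
def Multigraph.IsCirculation [Fintype E] [DecidableEq V] (G : Multigraph V E)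
    (r : V → ℤ) (F : Finset E) (f : E → ℤ) : Prop :=
  (∀ e, e ∉ F → f e = 0) ∧ (∀ e, |f e| ≤ (G.u e : ℤ)) ∧ (∀ v, G.residue f v = r v)

/-- The minimum cost (in `ℕ∞`) of a subset `F` of the allowed edge set `E'`
admitting an `r`-circulation supported on `F`.  Taking `E' = Finset.univ`
gives `mincost(G, r)`; taking `E' = E₁` for a sub-multigraph `(V₁, E₁)` all of
whose edges have both endpoints in `V₁` gives `mincost(G₁, r)` whenever `r`
vanishes outside `V₁`. -/
noncomputable def Multigraph.mincostOn [Fintype E] [DecidableEq V] (G : Multigraph V E)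
    (E' : Finset E) (r : V → ℤ) : ℕ∞ :=
  ⨅ (F : Finset E) (_ : F ⊆ E' ∧ ∃ f : E → ℤ, G.IsCirculation r F f),
    ((∑ e ∈ F, G.c e : ℕ) : ℕ∞)

namespace Multigraph

variable [Fintype E] [DecidableEq V]

lemma residue_add (G : Multigraph V E) (f g : E → ℤ) (v : V) :
    G.residue (f + g) v = G.residue f v + G.residue g v := by
  have key : ∀ h : E → V, (∑ e, if h e = v then (f + g) e else 0) =
      (∑ e, if h e = v then f e else 0) + ∑ e, if h e = v then g e else 0 := by
    intro h
    rw [← Finset.sum_add_distrib]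
    refine Finset.sum_congr rfl fun e _ => ?_
    split_ifs <;> simp
  simp only [residue, key]
  ring

lemma sum_residue [Fintype V] (G : Multigraph V E) (f : E → ℤ) :
    ∑ v, G.residue f v = 0 := by
  simp only [residue, Finset.sum_sub_distrib]
  rw [Finset.sum_comm, Finset.sum_comm (f := fun v e => if G.src e = v then f e else 0)]
  simp

lemma residue_eq_zero (G : Multigraph V E) {V' : Finset V} {E' : Finset E}
    (hG : ∀ e ∈ E', G.src e ∈ V' ∧ G.tgt e ∈ V') {f : E → ℤ} (hf : ∀ e, e ∉ E' → f e = 0)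
    {v : V} (hv : v ∉ V') : G.residue f v = 0 := by
  have key : ∀ h : E → V, (∀ e ∈ E', h e ∈ V') → (∑ e, if h e = v then f e else 0) = 0 := by
    intro h hh
    refine Finset.sum_eq_zero fun e _ => ?_
    by_cases he : e ∈ E'
    · rw [if_neg]
      rintro rfl
      exact hv (hh e he)
    · simp [hf e he]
  rw [residue, key _ fun e he => (hG e he).2, key _ fun e he => (hG e he).1, sub_zero]

/-- Two functions on a finite type with equal sums that agree away from a point are equal. -/
lemma eq_of_sum_eq_of_eq_off [Fintype V] {p q : V → ℤ} (t : V) (hsum : ∑ v, p v = ∑ v, q v)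
    (h : ∀ v, v ≠ t → p v = q v) : p = q := by
  funext v
  by_cases hv : v = t
  · subst hv
    rw [← Finset.add_sum_erase _ p (Finset.mem_univ v),
      ← Finset.add_sum_erase _ q (Finset.mem_univ v),
      Finset.sum_congr rfl fun w hw => h w (Finset.ne_of_mem_erase hw)] at hsum
    exact add_right_cancel hsum
  · exact h v hv

lemma mincostOn_le (G : Multigraph V E) {E' F : Finset E} {r : V → ℤ} {f : E → ℤ}
    (hF : F ⊆ E') (hf : G.IsCirculation r F f) :
    G.mincostOn E' r ≤ ((∑ e ∈ F, G.c e : ℕ) : ℕ∞) :=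
  iInf₂_le F ⟨hF, f, hf⟩

/-- Circulations on edge-disjoint parts add up to a circulation on the union. -/
lemma IsCirculation.union [DecidableEq E] {G : Multigraph V E} {F₁ F₂ : Finset E}
    (hd : Disjoint F₁ F₂) {r₁ r₂ : V → ℤ} {f₁ f₂ : E → ℤ} (h₁ : G.IsCirculation r₁ F₁ f₁)
    (h₂ : G.IsCirculation r₂ F₂ f₂) : G.IsCirculation (r₁ + r₂) (F₁ ∪ F₂) (f₁ + f₂) := by
  refine ⟨fun e he => ?_, fun e => ?_, fun v => ?_⟩
  · rw [Finset.mem_union, not_or] at he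
    simp [h₁.1 e he.1, h₂.1 e he.2]
  · by_cases he : e ∈ F₁
    · simpa [h₂.1 e (Finset.disjoint_left.1 hd he)] using h₁.2.1 e
    · simpa [h₁.1 e he] using h₂.2.1 e
  · rw [residue_add, h₁.2.2, h₂.2.2, Pi.add_apply]

/-- In a series composition at `t`, the minimum cost splits along any decomposition of the
residues into balanced parts living on the two sides. -/
lemma mincostOn_univ_series [Fintype V] [DecidableEq E] (G : Multigraph V E)
    {V₁ V₂ : Finset V} {E₁ E₂ : Finset E} (hE : E₁ ∪ E₂ = Finset.univ) (hd : Disjoint E₁ E₂)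
    (hG₁ : ∀ e ∈ E₁, G.src e ∈ V₁ ∧ G.tgt e ∈ V₁)
    (hG₂ : ∀ e ∈ E₂, G.src e ∈ V₂ ∧ G.tgt e ∈ V₂)
    {t : V} (hVt : V₁ ∩ V₂ = {t}) {r₁ r₂ : V → ℤ}
    (hr₁ : ∀ v, v ∉ V₁ → r₁ v = 0) (hr₂ : ∀ v, v ∉ V₂ → r₂ v = 0)
    (hsum : ∑ v, r₁ v = 0) :
    G.mincostOn Finset.univ (r₁ + r₂) = G.mincostOn E₁ r₁ + G.mincostOn E₂ r₂ := by
  apply le_antisymm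
  · refine ENat.le_iInf₂_add_iInf₂ fun F₁ ⟨hF₁, f₁, h₁⟩ F₂ ⟨hF₂, f₂, h₂⟩ => ?_
    have hF := Finset.disjoint_of_subset_left hF₁ (Finset.disjoint_of_subset_right hF₂ hd)
    rw [← Nat.cast_add, ← Finset.sum_union hF]
    exact mincostOn_le G (Finset.subset_univ _) (h₁.union hF h₂)
  · refine le_iInf₂ fun F ⟨_, f, hf, hu, hr⟩ => ?_
    let g : Finset E → E → ℤ := fun E' e => if e ∈ E' then f e else 0
    have hg : ∀ E' e, e ∉ E' → g E' e = 0 := fun E' e he => if_neg he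
    have hgF : ∀ E' e, e ∉ F ∩ E' → g E' e = 0 := by
      intro E' e he
      by_cases h : e ∈ E'
      · simp [g, hf e fun hF => he (Finset.mem_inter.2 ⟨hF, h⟩)]
      · exact hg _ _ h
    have hgu : ∀ E' e, |g E' e| ≤ (G.u e : ℤ) := by
      intro E' e
      by_cases h : e ∈ E'
      · simpa [g, h] using hu e
      · simp [g, h]
    have hfg : f = g E₁ + g E₂ := by
      funext e
      have he : e ∈ E₁ ∪ E₂ := hE ▸ Finset.mem_univ e
      by_cases h : e ∈ E₁
      · simp [g, h, Finset.disjoint_left.1 hd h]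
      · simp [g, h, (Finset.mem_union.1 he).resolve_left h]
    have hadd : ∀ v, G.residue (g E₁) v + G.residue (g E₂) v = r₁ v + r₂ v := by
      intro v
      rw [← residue_add, ← hfg, hr, Pi.add_apply]
    have hres₁ : G.residue (g E₁) = r₁ := by
      refine eq_of_sum_eq_of_eq_off t ((sum_residue G _).trans hsum.symm) fun v hv => ?_
      by_cases h₁ : v ∈ V₁
      · have h₂ : v ∉ V₂ := fun h₂ =>
          hv (Finset.mem_singleton.1 (hVt ▸ Finset.mem_inter.2 ⟨h₁, h₂⟩))
        simpa [residue_eq_zero G hG₂ (hg E₂) h₂, hr₂ v h₂] using hadd v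
      · rw [residue_eq_zero G hG₁ (hg E₁) h₁, hr₁ v h₁]
    have hc₁ : G.IsCirculation r₁ (F ∩ E₁) (g E₁) := ⟨hgF E₁, hgu E₁, fun v => by rw [hres₁]⟩
    have hc₂ : G.IsCirculation r₂ (F ∩ E₂) (g E₂) := by
      refine ⟨hgF E₂, hgu E₂, fun v => ?_⟩
      have := hadd v
      rw [hres₁] at this
      exact add_left_cancel this
    refine (add_le_add (mincostOn_le G Finset.inter_subset_right hc₁)
      (mincostOn_le G Finset.inter_subset_right hc₂)).trans_eq ?_
    rw [← Nat.cast_add, ← Finset.sum_union (Finset.disjoint_of_subset_left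
      Finset.inter_subset_right (Finset.disjoint_of_subset_right Finset.inter_subset_right hd)),
      ← Finset.inter_union_distrib_left, hE, Finset.inter_univ]

end Multigraph

/-- Case 3.1: series composition splitting at `t`, 4-tuple of residues. -/
theorem series_four_tuple_split_at_t {V E : Type}
    [Fintype V] [Fintype E] [DecidableEq V] [DecidableEq E]
    (G : Multigraph V E) (V1 V2 : Finset V) (E1 E2 : Finset E)
    (hE : E1 ∪ E2 = Finset.univ) (hEdisj : Disjoint E1 E2)
    (hV : V1 ∪ V2 = Finset.univ)
    (hG1 : ∀ e ∈ E1, G.src e ∈ V1 ∧ G.tgt e ∈ V1)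
    (hG2 : ∀ e ∈ E2, G.src e ∈ V2 ∧ G.tgt e ∈ V2)
    (t a s b : V) (hVx : V1 ∩ V2 = {t})
    (ha : a ∈ V1) (hat : a ≠ t) (hs : s ∈ V1) (hst : s ≠ t) (has : a ≠ s)
    (hb : b ∈ V2) (hbt : b ≠ t)
    (ra rs rt rb : ℤ) (hsum : ra + rs + rt + rb = 0) :
    G.mincostOn Finset.univ
        (fun v => if v = a then ra else if v = s then rs else if v = t then rt
          else if v = b then rb else 0) =
      G.mincostOn E1
        (fun v => if v = a then ra else if v = s then rs else if v = t then -ra - rs else 0) +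
      G.mincostOn E2 (fun v => if v = t then rt + ra + rs else if v = b then rb else 0) := by
  have hmem : ∀ v ∈ V1, v ≠ t → v ∉ V2 := fun v h₁ hv h₂ =>
    hv (Finset.mem_singleton.1 (hVx ▸ Finset.mem_inter.2 ⟨h₁, h₂⟩))
  have ht : t ∈ V1 ∩ V2 := hVx ▸ Finset.mem_singleton_self t
  obtain ⟨ht₁, ht₂⟩ := Finset.mem_inter.1 ht
  have hab : a ≠ b := fun h => hmem a ha hat (h ▸ hb)
  have hsb : s ≠ b := fun h => hmem s hs hst (h ▸ hb)
  rw [← Multigraph.mincostOn_univ_series G hE hEdisj hG1 hG2 hVx]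
  · congr 1
    funext v
    simp only [Pi.add_apply]
    grind
  · grind
  · grind
  · have : ∀ v, (if v = a then ra else if v = s then rs else if v = t then -ra - rs else 0) =
        (if v = a then ra else 0) + (if v = s then rs else 0) +
          (if v = t then -ra - rs else 0) := by grind
    simp [this, Finset.sum_add_distrib]
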